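/- Let f(t,x,y) = (1/8)|y|^{5/4} − 5x³ + 2ζ_t·x and g(t,x,y) = (1/2)|x|^{3/2} + ζ_t·y with ζ_t = (t(1−t))^{3/4}, and let U(m,n) = (1/4)(m − n)²(m² + n²). Then for all t ∈ [0,1] and all x, x̄, y, ȳ ∈ ℝ, (x − x̄)·(f(t,x,y) − f(t,x̄,ȳ)) + (g(t,x,y) − g(t,x̄,ȳ))² ≤ 8(x − x̄)² + 8(y − ȳ)² − U(x,x̄) + U(y,ȳ). -/

import Mathlib

noncomputable def zeta (t : ℝ) : ℝ := (t * (1 - t)) ^ ((3:ℝ)/4)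

noncomputable def exDrift (t x y : ℝ) : ℝ :=
  (1/8) * |y| ^ ((5:ℝ)/4) - 5 * x ^ 3 + 2 * zeta t * x

noncomputable def exDiffusion (t x y : ℝ) : ℝ :=
  (1/2) * |x| ^ ((3:ℝ)/2) + zeta t * y

noncomputable def exU (m n : ℝ) : ℝ := (1/4) * (m - n) ^ 2 * (m ^ 2 + n ^ 2)

lemma abs_pow_sub_pow_le_mul_add (n : ℕ) {p q : ℝ} (hp : 0 ≤ p) (hq : 0 ≤ q) :
    |p ^ (n + 2) - q ^ (n + 2)| ≤ |p ^ (n + 1) - q ^ (n + 1)| * (p + q) := by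
  wlog h : q ≤ p generalizing p q
  · rw [abs_sub_comm, abs_sub_comm (p ^ (n + 1)), add_comm p]
    exact this hq hp (le_of_not_ge h)
  have hpow (m : ℕ) : q ^ m ≤ p ^ m := pow_le_pow_left₀ hq h m
  rw [abs_of_nonneg (sub_nonneg.2 (hpow _)), abs_of_nonneg (sub_nonneg.2 (hpow _))]
  have := mul_nonneg (mul_nonneg hp hq) (sub_nonneg.2 (hpow n))
  linear_combination this

lemma sq_abs_rpow_sub_le (n : ℕ) (x z : ℝ) :
    (|x| ^ ((n + 2 : ℝ) / (n + 1)) - |z| ^ ((n + 2 : ℝ) / (n + 1))) ^ 2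
      ≤ 2 * (x - z) ^ 2 * ((|x| ^ (1 / (n + 1 : ℝ))) ^ 2 + (|z| ^ (1 / (n + 1 : ℝ))) ^ 2) := by
  have hn : (n + 1 : ℝ) ≠ 0 := by positivity
  have hroot (w : ℝ) : (|w| ^ (1 / (n + 1 : ℝ))) ^ (n + 1) = |w| := by
    rw [← Real.rpow_mul_natCast (abs_nonneg w)]
    push_cast
    rw [one_div_mul_cancel hn, Real.rpow_one]
  have hpow (w : ℝ) : |w| ^ ((n + 2 : ℝ) / (n + 1)) = (|w| ^ (1 / (n + 1 : ℝ))) ^ (n + 2) := by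
    rw [← Real.rpow_mul_natCast (abs_nonneg w)]
    push_cast
    congr 1
    ring
  rw [hpow, hpow]
  have hp : 0 ≤ |x| ^ (1 / (n + 1 : ℝ)) := by positivity
  have hq : 0 ≤ |z| ^ (1 / (n + 1 : ℝ)) := by positivity
  have key := abs_pow_sub_pow_le_mul_add n hp hq
  rw [hroot, hroot] at key
  generalize |x| ^ (1 / (n + 1 : ℝ)) = p at *
  generalize |z| ^ (1 / (n + 1 : ℝ)) = q at *
  calc (p ^ (n + 2) - q ^ (n + 2)) ^ 2 = |p ^ (n + 2) - q ^ (n + 2)| ^ 2 := (sq_abs _).symm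
    _ ≤ (|x - z| * (p + q)) ^ 2 := by
        gcongr
        exact key.trans (mul_le_mul_of_nonneg_right (abs_abs_sub_abs_le_abs_sub x z) (add_nonneg hp hq))
    _ = (x - z) ^ 2 * (p + q) ^ 2 := by rw [mul_pow, sq_abs]
    _ ≤ (x - z) ^ 2 * (2 * (p ^ 2 + q ^ 2)) := by
        gcongr
        linarith [sq_nonneg (p - q)]
    _ = 2 * (x - z) ^ 2 * (p ^ 2 + q ^ 2) := by ring

lemma sq_abs_rpow_three_halves_sub_le (x z : ℝ) :
    (|x| ^ ((3 : ℝ) / 2) - |z| ^ ((3 : ℝ) / 2)) ^ 2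
      ≤ 2 * (x - z) ^ 2 * (x ^ 2 + z ^ 2 + 1 / 2) := by
  have h := sq_abs_rpow_sub_le 1 x z
  norm_num only [Nat.cast_one] at h
  have hb (w : ℝ) : (|w| ^ ((1 : ℝ) / 2)) ^ 2 ≤ w ^ 2 + 1 / 4 := by
    rw [← Real.sqrt_eq_rpow, Real.sq_sqrt (abs_nonneg w), ← sq_abs w]
    linarith [sq_nonneg (|w| - 1 / 2)]
  refine h.trans (mul_le_mul_of_nonneg_left ?_ (by positivity))
  linarith [hb x, hb z]

lemma sq_abs_rpow_five_quarters_sub_le (y z : ℝ) :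
    (|y| ^ ((5 : ℝ) / 4) - |z| ^ ((5 : ℝ) / 4)) ^ 2
      ≤ 2 * (y - z) ^ 2 * (y ^ 2 + z ^ 2 + 2) := by
  have h := sq_abs_rpow_sub_le 3 y z
  norm_num only [Nat.cast_ofNat] at h
  have hb (w : ℝ) : (|w| ^ ((1 : ℝ) / 4)) ^ 2 ≤ w ^ 2 + 1 := by
    have hw : ((|w| ^ ((1 : ℝ) / 4)) ^ 2) ^ 2 = |w| := by
      rw [← pow_mul, ← Real.rpow_mul_natCast (abs_nonneg w)]
      norm_num
    have hsq := sq_abs w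
    linarith [sq_nonneg ((|w| ^ ((1 : ℝ) / 4)) ^ 2 - 1 / 2), sq_nonneg (|w| - 1 / 2)]
  refine h.trans (mul_le_mul_of_nonneg_left ?_ (by positivity))
  linarith [hb y, hb z]

lemma zeta_mem_Icc {t : ℝ} (ht : t ∈ Set.Icc (0 : ℝ) 1) : zeta t ∈ Set.Icc (0 : ℝ) 1 := by
  obtain ⟨h0, h1⟩ := ht
  have h : 0 ≤ t * (1 - t) := mul_nonneg h0 (sub_nonneg.2 h1)
  exact ⟨Real.rpow_nonneg h _,
    Real.rpow_le_one h (by linarith [sq_nonneg (t - 1 / 2)]) (by norm_num)⟩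

/-- Verification of Assumption 3.2 (generalized monotone condition with
compensating function `U`, with q = 2) for the example SDDE. -/
theorem example_generalized_monotone :
    ∀ t ∈ Set.Icc (0:ℝ) 1, ∀ x xb y yb : ℝ,
      (x - xb) * (exDrift t x y - exDrift t xb yb)
          + (exDiffusion t x y - exDiffusion t xb yb) ^ 2
        ≤ 8 * (x - xb) ^ 2 + 8 * (y - yb) ^ 2 - exU x xb + exU y yb := by
  intro t ht x xb y yb
  obtain ⟨hz0, hz1⟩ := zeta_mem_Icc ht
  have hP := sq_abs_rpow_three_halves_sub_le x xb
  have hQ := sq_abs_rpow_five_quarters_sub_le y yb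
  unfold exDrift exDiffusion exU
  generalize zeta t = ζ at *
  generalize |x| ^ ((3 : ℝ) / 2) = a at *
  generalize |xb| ^ ((3 : ℝ) / 2) = b at *
  generalize |y| ^ ((5 : ℝ) / 4) = c at *
  generalize |yb| ^ ((5 : ℝ) / 4) = d at *
  have hdrift : ζ * (x - xb) ^ 2 ≤ (x - xb) ^ 2 := mul_le_of_le_one_left (sq_nonneg _) hz1
  have hdiff : ζ ^ 2 * (y - yb) ^ 2 ≤ (y - yb) ^ 2 :=
    mul_le_of_le_one_left (sq_nonneg _) (pow_le_one₀ hz0 hz1)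
  have hsplit := sq_nonneg ((a - b) / 2 - ζ * (y - yb))
  have hyoung := sq_nonneg ((x - xb) - (c - d) / 16)
  have hcube := mul_nonneg (sq_nonneg (x - xb)) (sq_nonneg (x + xb))
  have hx := mul_nonneg (sq_nonneg (x - xb)) (add_nonneg (sq_nonneg x) (sq_nonneg xb))
  have hy := mul_nonneg (sq_nonneg (y - yb)) (add_nonneg (sq_nonneg y) (sq_nonneg yb))
  nlinarith [sq_nonneg (x - xb), sq_nonneg (y - yb)]
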